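/- Let s* be a global minimizer over ℝ^n of m(s) = f₀ + ⟨g,s⟩ + (1/2)⟨Hs,s⟩ + (σ/6) N(s)³, and let u be an eigenvector of H associated with the smallest eigenvalue λ_min[H], with ‖u‖₂ = 1 and N(u) ≤ 1, whose sign is chosen so that ⟨g + Hs*, u⟩ ≤ 0. Then for all θ₁ ≥ 1 and θ₂ ≥ 1 the step acceptance conditions of the AR2GN algorithm hold at s*: (i) m(s*) ≤ m(0); (ii) ‖g + Hs*‖_{N,1} ≤ θ₁ (σ/2) N(s*)²; (iii) λ_min[H] + θ₂ ω(s*) σ N(s*) ≥ 0, where ω(s) := 1 + (2/√3)√ψ(s) for s ≠ 0 with ψ(s) := max[0, 1 + 2⟨g + Hs, u⟩/(σ N(s)²)], and ω(0) := 1. -/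

import Mathlib

open scoped RealInnerProductSpace Classical

noncomputable section

/-- Abbreviation for the Euclidean space `ℝ^n`. -/
abbrev E (n : ℕ) := EuclideanSpace ℝ (Fin n)

/-- `N` is a norm on `ℝ^n` (possibly non-smooth, e.g. `ℓ¹` or `ℓ∞`). -/
structure IsNorm (n : ℕ) (N : E n → ℝ) : Prop where
  add_le : ∀ x y, N (x + y) ≤ N x + N y
  smul : ∀ (c : ℝ) (x : E n), N (c • x) = |c| * N x
  eq_zero : ∀ x, N x = 0 → x = 0

/-- The dual norm `‖v‖_{N,1} := max_{N s = 1} ⟪v, s⟫`. -/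
def dualNorm (n : ℕ) (N : E n → ℝ) (v : E n) : ℝ :=
  sSup {t : ℝ | ∃ s, N s = 1 ∧ t = ⟪v, s⟫}

/-- The smallest eigenvalue of a symmetric operator `A`, as the infimum of the
Rayleigh quotient over the Euclidean unit sphere. -/
def lamMin (n : ℕ) (A : E n →L[ℝ] E n) : ℝ :=
  sInf {t : ℝ | ∃ v : E n, ‖v‖ = 1 ∧ t = ⟪A v, v⟫}

/-- The norm `‖H‖_{N,2} := max_{N s = 1} |⟪H s, s⟫|` of a symmetric operator induced by `N`. -/
def matNormN (n : ℕ) (N : E n → ℝ) (A : E n →L[ℝ] E n) : ℝ :=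
  sSup {t : ℝ | ∃ v : E n, N v = 1 ∧ t = |⟪A v, v⟫|}

/-- The regularized quadratic model
`m(s) = f₀ + ⟪g,s⟫ + (1/2)⟪Hs,s⟫ + (σ/6) N(s)³`. -/
def qm (n : ℕ) (N : E n → ℝ) (f0 : ℝ) (g : E n) (H : E n →L[ℝ] E n) (σ : ℝ)
    (s : E n) : ℝ :=
  f0 + ⟪g, s⟫ + (1 / 2) * ⟪H s, s⟫ + σ / 6 * N s ^ 3

theorem IsNorm.nonneg {n : ℕ} {N : E n → ℝ} (hN : IsNorm n N) (x : E n) : 0 ≤ N x := by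
  have h0 : N (0 : E n) = 0 := by simpa using hN.smul 0 0
  have hneg : N (-x) = N x := by simpa using hN.smul (-1) x
  have h := hN.add_le x (-x)
  rw [add_neg_cancel, h0, hneg] at h
  linarith

/-- Comparing a global minimizer of the model with a step of length `t` along `d`. -/
theorem qm_step_nonneg {n : ℕ} {N : E n → ℝ} (hN : IsNorm n N)
    {f0 : ℝ} {g : E n} {H : E n →L[ℝ] E n} (hH : ∀ x y : E n, ⟪H x, y⟫ = ⟪x, H y⟫)
    {σ : ℝ} (hσ : 0 < σ) {s : E n} (hmin : ∀ t, qm n N f0 g H σ s ≤ qm n N f0 g H σ t)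
    {d : E n} (hd : N d ≤ 1) {t : ℝ} (ht : 0 < t) :
    0 ≤ ⟪g + H s, d⟫ + t / 2 * ⟪H d, d⟫ + σ / 6 * (3 * N s ^ 2 + 3 * N s * t + t ^ 2) := by
  have hle : N (s + t • d) ≤ N s + t := by
    have h1 := hN.add_le s (t • d)
    rw [hN.smul, abs_of_pos ht] at h1
    nlinarith
  have hcube : N (s + t • d) ^ 3 ≤ (N s + t) ^ 3 := pow_le_pow_left₀ (hN.nonneg _) hle 3
  have hsymm : ⟪H d, s⟫ = ⟪H s, d⟫ := by rw [hH, real_inner_comm]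
  have h := hmin (s + t • d)
  simp only [qm, map_add, map_smul, inner_add_left, inner_add_right, real_inner_smul_left,
    real_inner_smul_right, hsymm] at h
  have hσ3 := mul_le_mul_of_nonneg_left hcube (by positivity : 0 ≤ σ / 6)
  refine nonneg_of_mul_nonneg_right (a := t) ?_ ht
  rw [inner_add_left]
  linarith

/-- First-order optimality along directions in the unit ball of `N`. -/
theorem neg_inner_le_of_forall_qm_le {n : ℕ} {N : E n → ℝ} (hN : IsNorm n N)
    {f0 : ℝ} {g : E n} {H : E n →L[ℝ] E n} (hH : ∀ x y : E n, ⟪H x, y⟫ = ⟪x, H y⟫)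
    {σ : ℝ} (hσ : 0 < σ) {s : E n} (hmin : ∀ t, qm n N f0 g H σ s ≤ qm n N f0 g H σ t)
    {d : E n} (hd : N d ≤ 1) : -⟪g + H s, d⟫ ≤ σ / 2 * N s ^ 2 := by
  have hlim : Filter.Tendsto
      (fun t : ℝ => ⟪g + H s, d⟫ + t / 2 * ⟪H d, d⟫ +
        σ / 6 * (3 * N s ^ 2 + 3 * N s * t + t ^ 2))
      (nhdsWithin 0 (Set.Ioi 0))
      (nhds (⟪g + H s, d⟫ + 0 / 2 * ⟪H d, d⟫ +
        σ / 6 * (3 * N s ^ 2 + 3 * N s * 0 + 0 ^ 2))) :=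
    Filter.Tendsto.mono_left
      (Continuous.tendsto (by fun_prop) 0) nhdsWithin_le_nhds
  have h := ge_of_tendsto hlim
    (Filter.eventually_of_mem self_mem_nhdsWithin fun t ht => qm_step_nonneg hN hH hσ hmin hd ht)
  linarith

/-- A quadratic `c + k t / 2 + σ t² / 6` that is nonnegative for `t > 0`, with
`c ≤ σ r² ψ / 2`, has its slope bounded below. -/
theorem slope_add_nonneg_of_quadratic_nonneg {σ r k c ψ : ℝ} (hσ : 0 < σ) (hr : 0 ≤ r)
    (hψ : 0 ≤ ψ) (hc : c ≤ σ * r ^ 2 * ψ / 2)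
    (h : ∀ t : ℝ, 0 < t → 0 ≤ c + k * t / 2 + σ * t ^ 2 / 6) :
    0 ≤ k + 2 / √3 * √ψ * σ * r := by
  have hB : 0 ≤ 2 / √3 * √ψ * σ * r := by positivity
  by_cases hk : 0 ≤ k
  · linarith
  have hk' : 0 < -k := by linarith
  have ht := h (3 * -k / (2 * σ)) (by positivity)
  have he : c + k * (3 * -k / (2 * σ)) / 2 + σ * (3 * -k / (2 * σ)) ^ 2 / 6
      = (c * (8 * σ) - 3 * k ^ 2) / (8 * σ) := by
    field_simp
    ring
  rw [he] at ht
  have hnum : 0 ≤ c * (8 * σ) - 3 * k ^ 2 := by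
    by_contra! hlt
    exact absurd (div_neg_of_neg_of_pos hlt (by positivity : 0 < 8 * σ)) (not_lt.2 ht)
  have hB2 : (2 / √3 * √ψ * σ * r) ^ 2 = 4 / 3 * ψ * σ ^ 2 * r ^ 2 := by
    rw [mul_pow, mul_pow, mul_pow, div_pow, Real.sq_sqrt hψ,
      Real.sq_sqrt (by norm_num : (0 : ℝ) ≤ 3)]
    ring
  have hsq : (-k) ^ 2 ≤ (2 / √3 * √ψ * σ * r) ^ 2 := by
    rw [hB2]
    nlinarith [mul_le_mul_of_nonneg_right hc (by positivity : 0 ≤ 8 * σ)]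
  linarith [(sq_le_sq₀ hk'.le hB).1 hsq]

/-- a global minimizer of the regularized quadratic satisfies the
AR2GN step acceptance conditions: for all `θ₁ ≥ 1` and `θ₂ ≥ 1`,
(i) `m(s*) ≤ m(0)`; (ii) `‖g + Hs*‖_{N,1} ≤ θ₁(σ/2)N(s*)²`;
(iii) `λ_min[H] + θ₂ ω(s*) σ N(s*) ≥ 0`. -/
theorem stmt19 {n : ℕ} (hn : 1 ≤ n) (N : E n → ℝ) (hN : IsNorm n N)
    (f0 : ℝ) (g : E n) (H : E n →L[ℝ] E n)
    (hH : ∀ x y : E n, ⟪H x, y⟫ = ⟪x, H y⟫)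
    (σ : ℝ) (hσ : 0 < σ) (sstar : E n)
    (hmin : ∀ t, qm n N f0 g H σ sstar ≤ qm n N f0 g H σ t)
    (u : E n) (hu : H u = lamMin n H • u) (hu2 : ‖u‖ = 1) (huN : N u ≤ 1)
    (hsign : ⟪g + H sstar, u⟫ ≤ 0) :
    ∀ θ1 θ2 : ℝ, 1 ≤ θ1 → 1 ≤ θ2 →
      qm n N f0 g H σ sstar ≤ qm n N f0 g H σ 0 ∧
        dualNorm n N (g + H sstar) ≤ θ1 * (σ / 2) * N sstar ^ 2 ∧
        0 ≤ lamMin n H +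
            θ2 * (if sstar = 0 then 1
              else 1 + 2 / Real.sqrt 3 *
                Real.sqrt (max 0 (1 + 2 * ⟪g + H sstar, u⟫ / (σ * N sstar ^ 2)))) *
              σ * N sstar := by
  intro θ1 θ2 h1 h2
  have hfirst : ∀ d, N d ≤ 1 → -⟪g + H sstar, d⟫ ≤ σ / 2 * N sstar ^ 2 :=
    fun d hd => neg_inner_le_of_forall_qm_le hN hH hσ hmin hd
  have hr := hN.nonneg sstar
  have huu : ⟪H u, u⟫ = lamMin n H := by
    rw [hu, real_inner_smul_left, real_inner_self_eq_norm_sq, hu2]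
    ring
  refine ⟨hmin 0, Real.sSup_le ?_ (by positivity), ?_⟩
  · rintro _ ⟨d, hd, rfl⟩
    have h := hfirst (-d) (by simpa [hd] using (hN.smul (-1) d).le)
    rw [inner_neg_right, neg_neg] at h
    have : 0 ≤ σ / 2 * N sstar ^ 2 := by positivity
    nlinarith
  have hquad : ∀ t : ℝ, 0 < t → 0 ≤ (⟪g + H sstar, u⟫ + σ / 2 * N sstar ^ 2) +
      (lamMin n H + σ * N sstar) * t / 2 + σ * t ^ 2 / 6 := fun t ht => by
    have h := qm_step_nonneg hN hH hσ hmin huN ht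
    rw [huu] at h
    linarith
  split_ifs with hs
  · have h0 : N sstar = 0 := by simpa [hs] using hN.smul 0 0
    have h := slope_add_nonneg_of_quadratic_nonneg hσ hr le_rfl
      (by rw [h0]; linarith) hquad
    simpa [h0] using h
  · have hrpos : 0 < N sstar := hr.lt_of_ne fun h => hs (hN.eq_zero _ h.symm)
    set ψ := max 0 (1 + 2 * ⟪g + H sstar, u⟫ / (σ * N sstar ^ 2)) with hψ
    have hc : ⟪g + H sstar, u⟫ + σ / 2 * N sstar ^ 2 ≤ σ * N sstar ^ 2 * ψ / 2 := by
      have he : σ * N sstar ^ 2 * (1 + 2 * ⟪g + H sstar, u⟫ / (σ * N sstar ^ 2)) / 2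
          = ⟪g + H sstar, u⟫ + σ / 2 * N sstar ^ 2 := by
        field_simp
        ring
      rw [← he]
      gcongr
      exact le_max_right _ _
    have h := slope_add_nonneg_of_quadratic_nonneg hσ hr (le_max_left _ _) hc hquad
    have hω : 0 ≤ (1 + 2 / √3 * √ψ) * σ * N sstar := by positivity
    linarith [mul_le_mul_of_nonneg_right h2 hω]
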